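/- arXiv:2007.01183 — 8 statements merged into one kernel-verified Lean document; each statement's English description precedes it below -/
import Mathlib

section
/- Let n, k ∈ ℕ with k ≤ n, and let C ∈ ℂ^{n×n} be invertible, partitioned columnwise as C = [C1, C2] with C1 ∈ ℂ^{n×k} and C2 ∈ ℂ^{n×(n−k)}. Then C2ᴴC2 is invertible, and the matrix X := C1 − C2 (C2ᴴ C2)⁻¹ C2ᴴ C1 (that is, the orthogonal projection of C1 onto the orthogonal complement of the column space of C2) is the Moore–Penrose pseudoinverse of M := [I_k, O] C⁻¹ (the matrix formed by the first k rows of C⁻¹); i.e., M X M = M, X M X = X, (M X)ᴴ = M X, and (X M)ᴴ = X M. -/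
open Matrix

namespace Matrix

variable {ι κ l 𝕜 : Type*} [Fintype ι] [Fintype κ] [Fintype l] [DecidableEq l] [RCLike 𝕜]

/-- The Gram matrix of a matrix with a left inverse is invertible. -/
theorem isUnit_conjTranspose_mul_self_of_mul_eq_one {B : Matrix ι l 𝕜} {N : Matrix l ι 𝕜}
    (hNB : N * B = 1) : IsUnit (Bᴴ * B) := by
  open scoped ComplexOrder in
  exact (PosDef.conjTranspose_mul_self B
    (Function.LeftInverse.injective (g := N.mulVec) fun v => by simp [hNB])).isUnit

/-- If `[A, B]` has two-sided inverse `[M; N]`, then projecting the columns of `A` onto the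
orthogonal complement of the column space of `B` gives the Moore–Penrose pseudoinverse of `M`. -/
theorem penrose_equations_of_block_inverse [DecidableEq ι] [DecidableEq κ]
    {A : Matrix ι κ 𝕜} {B : Matrix ι l 𝕜}
    {M : Matrix κ ι 𝕜} {N : Matrix l ι 𝕜} (hMA : M * A = 1) (hMB : M * B = 0) (hNB : N * B = 1)
    (hAM : A * M + B * N = 1) {X : Matrix ι κ 𝕜} (hX : X = A - B * (Bᴴ * B)⁻¹ * Bᴴ * A) :
    M * X * M = M ∧ X * M * X = X ∧ (M * X)ᴴ = M * X ∧ (X * M)ᴴ = X * M := by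
  have hdet := (isUnit_iff_isUnit_det _).mp (isUnit_conjTranspose_mul_self_of_mul_eq_one hNB)
  have hMX : M * X = 1 := by
    simp [hX, Matrix.mul_sub, hMA, ← Matrix.mul_assoc, hMB]
  have hPB : B * (Bᴴ * B)⁻¹ * Bᴴ * B = B := by
    rw [Matrix.mul_assoc, Matrix.mul_assoc, nonsing_inv_mul _ hdet, Matrix.mul_one]
  have hXM : X * M = 1 - B * (Bᴴ * B)⁻¹ * Bᴴ := by
    rw [hX, Matrix.sub_mul, Matrix.mul_assoc _ A M, eq_sub_of_add_eq hAM, Matrix.mul_sub,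
      ← Matrix.mul_assoc _ B N, hPB, Matrix.mul_one]
    abel
  refine ⟨by rw [hMX, Matrix.one_mul], by rw [Matrix.mul_assoc, hMX, Matrix.mul_one],
    by rw [hMX, conjTranspose_one], ?_⟩
  rw [hXM]
  simp [conjTranspose_nonsing_inv, Matrix.mul_assoc]

end Matrix

/-- Let `k ≤ n` and let `C ∈ ℂ^{n×n}` be invertible, partitioned columnwise as
`C = [C1, C2]` with `C1 ∈ ℂ^{n×k}`, `C2 ∈ ℂ^{n×(n-k)}`. Then `C2ᴴ C2` is invertible and
`X = C1 - C2 (C2ᴴ C2)⁻¹ C2ᴴ C1` (the orthogonal projection of `C1` onto the orthogonal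
complement of the column space of `C2`) is the Moore–Penrose pseudoinverse of
`M = [I_k, O] C⁻¹`, the matrix formed by the first `k` rows of `C⁻¹`. -/
theorem pinv_first_rows_of_inverse (n k : ℕ) (hk : k ≤ n)
    (C : Matrix (Fin n) (Fin n) ℂ) (hC : IsUnit C)
    (C1 : Matrix (Fin n) (Fin k) ℂ)
    (hC1 : ∀ (i : Fin n) (j : Fin k), C1 i j = C i ⟨j, lt_of_lt_of_le j.isLt hk⟩)
    (C2 : Matrix (Fin n) (Fin (n - k)) ℂ)
    (hC2 : ∀ (i : Fin n) (j : Fin (n - k)), C2 i j = C i ⟨k + j, by have := j.isLt; omega⟩)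
    (M : Matrix (Fin k) (Fin n) ℂ)
    (hM : ∀ (i : Fin k) (j : Fin n), M i j = C⁻¹ ⟨i, lt_of_lt_of_le i.isLt hk⟩ j)
    (X : Matrix (Fin n) (Fin k) ℂ)
    (hX : X = C1 - C2 * (C2ᴴ * C2)⁻¹ * C2ᴴ * C1) :
    IsUnit (C2ᴴ * C2) ∧
    M * X * M = M ∧ X * M * X = X ∧ (M * X)ᴴ = M * X ∧ (X * M)ᴴ = X * M := by
  have hdet : IsUnit C.det := (isUnit_iff_isUnit_det C).mp hC
  let e : Fin k ⊕ Fin (n - k) ≃ Fin n := finSumFinEquiv.trans (finCongr (by omega))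
  obtain rfl : C1 = C.submatrix id (e ∘ Sum.inl) := by
    ext i j
    exact hC1 i j
  obtain rfl : C2 = C.submatrix id (e ∘ Sum.inr) := by
    ext i j
    exact hC2 i j
  obtain rfl : M = C⁻¹.submatrix (e ∘ Sum.inl) id := by
    ext i j
    exact hM i j
  have hinv {κ l : Type} (f : κ → Fin n) (g : l → Fin n) :
      C⁻¹.submatrix f id * C.submatrix id g = (1 : Matrix (Fin n) (Fin n) ℂ).submatrix f g := by
    rw [← submatrix_mul _ _ _ _ _ Function.bijective_id, nonsing_inv_mul _ hdet]
  have hNB : C⁻¹.submatrix (e ∘ Sum.inr) id * C.submatrix id (e ∘ Sum.inr) = 1 := by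
    rw [hinv, submatrix_one _ (e.injective.comp Sum.inr_injective)]
  refine ⟨isUnit_conjTranspose_mul_self_of_mul_eq_one hNB,
    penrose_equations_of_block_inverse ?_ ?_ hNB ?_ hX⟩
  · rw [hinv, submatrix_one _ (e.injective.comp Sum.inl_injective)]
  · rw [hinv]
    ext i j
    simp [one_apply]
  · rw [← mul_nonsing_inv C hdet]
    ext i j
    simp [mul_apply, ← e.sum_comp]
end

section
/- Let n, k ∈ ℕ with k ≤ n, and let C ∈ ℂ^{n×n} be invertible, partitioned rowwise as C = [C1; C2] with C1 ∈ ℂ^{k×n} and C2 ∈ ℂ^{(n−k)×n}. Then C2 C2ᴴ is invertible, and the matrix X := C1 (I − C2ᴴ (C2 C2ᴴ)⁻¹ C2) is the Moore–Penrose pseudoinverse of M := C⁻¹ [I_k; O] (the matrix formed by the first k columns of C⁻¹); i.e., M X M = M, X M X = X, (M X)ᴴ = M X, and (X M)ᴴ = X M. -/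
open Matrix

open scoped ComplexOrder in
/-- A complex matrix with a right inverse has an invertible Gram matrix `B * Bᴴ`. -/
theorem Matrix.isUnit_mul_conjTranspose_self_of_mul_eq_one {m n : Type*} [Fintype m]
    [DecidableEq m] [Fintype n] {B : Matrix m n ℂ} {N : Matrix n m ℂ} (hBN : B * N = 1) :
    IsUnit (B * Bᴴ) := by
  refine (PosDef.mul_conjTranspose_self B fun v w hvw => ?_).isUnit
  simpa [vecMul_vecMul, hBN] using congrArg (· ᵥ* N) hvw

/-- If `[A; B]` has the two-sided inverse `[M, N]`, then compressing `A` to the orthogonal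
complement of the row space of `B` gives a matrix satisfying the Penrose equations for `M`. -/
theorem Matrix.penrose_equations_of_block_inverse_s1 {m n p : Type*} [Fintype m] [DecidableEq m]
    [Fintype n] [DecidableEq n] [Fintype p] [DecidableEq p]
    {A : Matrix p n ℂ} {B : Matrix m n ℂ} {M : Matrix n p ℂ} {N : Matrix n m ℂ}
    (hAM : A * M = 1) (hBM : B * M = 0) (hMN : M * A + N * B = 1) (hB : IsUnit (B * Bᴴ))
    {X : Matrix p n ℂ} (hX : X = A * (1 - Bᴴ * (B * Bᴴ)⁻¹ * B)) :
    M * X * M = M ∧ X * M * X = X ∧ (M * X)ᴴ = M * X ∧ (X * M)ᴴ = X * M := by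
  have hXM : X * M = 1 := by
    simp [hX, Matrix.mul_assoc, Matrix.sub_mul, hBM, hAM]
  have hBP : B * (1 - Bᴴ * (B * Bᴴ)⁻¹ * B) = 0 := by
    rw [Matrix.mul_sub, ← Matrix.mul_assoc, ← Matrix.mul_assoc,
      mul_nonsing_inv _ ((isUnit_iff_isUnit_det _).mp hB)]
    simp
  have hMX : M * X = 1 - Bᴴ * (B * Bᴴ)⁻¹ * B := by
    rw [hX, ← Matrix.mul_assoc, eq_sub_of_add_eq hMN, Matrix.sub_mul, Matrix.mul_assoc N, hBP]
    simp
  refine ⟨by rw [Matrix.mul_assoc, hXM, Matrix.mul_one], by rw [hXM, Matrix.one_mul], ?_,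
    by rw [hXM, conjTranspose_one]⟩
  rw [hMX]
  simp [conjTranspose_mul, conjTranspose_nonsing_inv, Matrix.mul_assoc]

/-- Let `k ≤ n` and let `C ∈ ℂ^{n×n}` be invertible, partitioned rowwise as
`C = [C1; C2]` with `C1 ∈ ℂ^{k×n}`, `C2 ∈ ℂ^{(n-k)×n}`. Then `C2 C2ᴴ` is invertible and
`X = C1 (I - C2ᴴ (C2 C2ᴴ)⁻¹ C2)` is the Moore–Penrose pseudoinverse of
`M = C⁻¹ [I_k; O]`, the matrix formed by the first `k` columns of `C⁻¹`. -/
theorem pinv_first_cols_of_inverse (n k : ℕ) (hk : k ≤ n)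
    (C : Matrix (Fin n) (Fin n) ℂ) (hC : IsUnit C)
    (C1 : Matrix (Fin k) (Fin n) ℂ)
    (hC1 : ∀ (i : Fin k) (j : Fin n), C1 i j = C ⟨i, lt_of_lt_of_le i.isLt hk⟩ j)
    (C2 : Matrix (Fin (n - k)) (Fin n) ℂ)
    (hC2 : ∀ (i : Fin (n - k)) (j : Fin n), C2 i j = C ⟨k + i, by have := i.isLt; omega⟩ j)
    (M : Matrix (Fin n) (Fin k) ℂ)
    (hM : ∀ (i : Fin n) (j : Fin k), M i j = C⁻¹ i ⟨j, lt_of_lt_of_le j.isLt hk⟩)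
    (X : Matrix (Fin k) (Fin n) ℂ)
    (hX : X = C1 * ((1 : Matrix (Fin n) (Fin n) ℂ) - C2ᴴ * (C2 * C2ᴴ)⁻¹ * C2)) :
    IsUnit (C2 * C2ᴴ) ∧
    M * X * M = M ∧ X * M * X = X ∧ (M * X)ᴴ = M * X ∧ (X * M)ᴴ = X * M := by
  have hdet := (isUnit_iff_isUnit_det C).mp hC
  let e : Fin k ⊕ Fin (n - k) ≃ Fin n := finSumFinEquiv.trans (finCongr (by omega))
  obtain rfl : C1 = C.submatrix (e ∘ Sum.inl) id := Matrix.ext hC1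
  obtain rfl : C2 = C.submatrix (e ∘ Sum.inr) id := Matrix.ext hC2
  obtain rfl : M = C⁻¹.submatrix id (e ∘ Sum.inl) := Matrix.ext hM
  have hBN : C.submatrix (e ∘ Sum.inr) id * C⁻¹.submatrix id (e ∘ Sum.inr) = 1 := by
    rw [← submatrix_mul _ _ _ _ _ Function.bijective_id, mul_nonsing_inv C hdet,
      submatrix_one _ (e.injective.comp Sum.inr_injective)]
  have hAM : C.submatrix (e ∘ Sum.inl) id * C⁻¹.submatrix id (e ∘ Sum.inl) = 1 := by
    rw [← submatrix_mul _ _ _ _ _ Function.bijective_id, mul_nonsing_inv C hdet,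
      submatrix_one _ (e.injective.comp Sum.inl_injective)]
  have hBM : C.submatrix (e ∘ Sum.inr) id * C⁻¹.submatrix id (e ∘ Sum.inl) = 0 := by
    rw [← submatrix_mul _ _ _ _ _ Function.bijective_id, mul_nonsing_inv C hdet]
    ext i j
    simp [one_apply]
  have hMN : C⁻¹.submatrix id (e ∘ Sum.inl) * C.submatrix (e ∘ Sum.inl) id +
      C⁻¹.submatrix id (e ∘ Sum.inr) * C.submatrix (e ∘ Sum.inr) id = 1 := by
    rw [← nonsing_inv_mul C hdet]
    ext i j
    simp only [Matrix.add_apply, mul_apply, submatrix_apply, id_eq, Function.comp_apply]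
    rw [← e.sum_comp, Fintype.sum_sum_type]
  have hB := isUnit_mul_conjTranspose_self_of_mul_eq_one hBN
  exact ⟨hB, penrose_equations_of_block_inverse_s1 hAM hBM hMN hB hX⟩
end

section
/- Let α, β, γ be finite index types, P an invertible complex matrix indexed by (α⊕β)×(α⊕β), Q an invertible complex matrix indexed by (α⊕γ)×(α⊕γ), and D an invertible complex matrix indexed by α×α. Write P_r for the α-rows of P, P_s for the β-rows of P, Q_r for the α-columns of Q, Q_s for the γ-columns of Q. Then P_s P_sᴴ and Q_sᴴ Q_s are invertible, and with Π_Q := I − Q_s(Q_sᴴQ_s)⁻¹Q_sᴴ and Π_P := I − P_sᴴ(P_sP_sᴴ)⁻¹P_s, the matrix X := (Π_Q Q_r) D⁻¹ (P_r Π_P) is the Moore–Penrose pseudoinverse of M := P⁻¹ · fromBlocks(D, O, O, O) · Q⁻¹, i.e., M X M = M, X M X = X, (M X)ᴴ = M X, and (X M)ᴴ = X M. -/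
open Matrix

open scoped ComplexOrder in
/-- A matrix with a left inverse has an invertible Gram matrix. -/
theorem Matrix.isUnit_conjTranspose_mul_self_of_mul_eq_one_s7 {m n : Type*} [Fintype m] [Fintype n]
    [DecidableEq n] {A : Matrix m n ℂ} {B : Matrix n m ℂ} (h : B * A = 1) :
    IsUnit (Aᴴ * A) := by
  refine (PosDef.conjTranspose_mul_self A fun x y hxy => ?_).isUnit
  simpa [h] using congrArg (B *ᵥ ·) hxy

/-- The projection onto the orthogonal complement of the column space of `A` annihilates `A`. -/
theorem Matrix.one_sub_gram_projection_mul_self {m n : Type*} [Fintype m] [Fintype n]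
    [DecidableEq m] [DecidableEq n] {A : Matrix m n ℂ} (h : IsUnit (Aᴴ * A)) :
    (1 - A * (Aᴴ * A)⁻¹ * Aᴴ) * A = 0 := by
  rw [Matrix.sub_mul, Matrix.one_mul, Matrix.mul_assoc, Matrix.mul_assoc,
    Matrix.nonsing_inv_mul _ ((isUnit_iff_isUnit_det _).1 h), Matrix.mul_one, sub_self]

/-- The projection onto the orthogonal complement of the column space of `A` is Hermitian. -/
theorem Matrix.isHermitian_one_sub_gram_projection {m n : Type*} [Fintype m] [Fintype n]
    [DecidableEq m] [DecidableEq n] (A : Matrix m n ℂ) :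
    (1 - A * (Aᴴ * A)⁻¹ * Aᴴ).IsHermitian :=
  isHermitian_one.sub
    (isHermitian_mul_mul_conjTranspose A (isHermitian_conjTranspose_mul_self A).inv)

/-- The Penrose equations for a full-rank factorization `U * D * V`, given Hermitian `E`, `F`
with `E = U * R * E`, `E * U = U`, `F = F * S * V`, `V * F = V`. -/
theorem Matrix.penrose_of_factorization {m n k : Type*} [Fintype m] [Fintype n] [Fintype k]
    [DecidableEq k]
    {D : Matrix k k ℂ} (hD : IsUnit D) {U : Matrix m k ℂ} {V : Matrix k n ℂ}
    {R : Matrix k m ℂ} {S : Matrix n k ℂ} {E : Matrix m m ℂ} {F : Matrix n n ℂ}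
    (hRU : R * U = 1) (hVS : V * S = 1)
    (hE : E.IsHermitian) (hF : F.IsHermitian) (hEU : E * U = U) (hVF : V * F = V)
    (hURE : U * R * E = E) (hFSV : F * S * V = F) :
    let X := F * S * D⁻¹ * (R * E)
    let M := U * D * V
    M * X * M = M ∧ X * M * X = X ∧ (M * X)ᴴ = M * X ∧ (X * M)ᴴ = X * M := by
  intro X M
  have hdet := (isUnit_iff_isUnit_det _).1 hD
  have hMX : M * X = E := by
    calc M * X = U * (D * ((V * F) * S) * D⁻¹) * R * E := by simp only [M, X, Matrix.mul_assoc]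
      _ = E := by rw [hVF, hVS, Matrix.mul_one, mul_nonsing_inv _ hdet, Matrix.mul_one, hURE]
  have hXM : X * M = F := by
    calc X * M = F * S * (D⁻¹ * (R * (E * U)) * D) * V := by simp only [M, X, Matrix.mul_assoc]
      _ = F := by rw [hEU, hRU, Matrix.mul_one, nonsing_inv_mul _ hdet, Matrix.mul_one, hFSV]
  have hFF : F * F = F := by
    calc F * F = F * S * (V * F) := by rw [← Matrix.mul_assoc, hFSV]
      _ = F := by rw [hVF, hFSV]
  refine ⟨?_, ?_, ?_, ?_⟩
  · rw [hMX]
    simp only [M, ← Matrix.mul_assoc, hEU]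
  · rw [hXM]
    simp only [X, ← Matrix.mul_assoc, hFF]
  · rw [hMX, hE.eq]
  · rw [hXM, hF.eq]

/-- Block multiplication with the inner index split as a sum type. -/
theorem Matrix.submatrix_inl_mul_add_submatrix_inr_mul {m n k l : Type*} [Fintype k] [Fintype l]
    (A : Matrix m (k ⊕ l) ℂ) (B : Matrix (k ⊕ l) n ℂ) :
    A.submatrix id Sum.inl * B.submatrix Sum.inl id +
      A.submatrix id Sum.inr * B.submatrix Sum.inr id = A * B := by
  ext i j
  simp [Matrix.mul_apply]

theorem Matrix.submatrix_mul_submatrix_of_mul_eq_one {n k l : Type*} [Fintype n] [DecidableEq n]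
    {A B : Matrix n n ℂ} (h : A * B = 1) (f : k → n) (g : l → n) :
    A.submatrix f id * B.submatrix id g = (1 : Matrix n n ℂ).submatrix f g := by
  rw [← h, submatrix_mul A B f id g Function.bijective_id]

/-- Decomposition of the pseudoinverse of a matrix pencil at a point where its regular
part `D` is invertible, when all singular Kronecker blocks have size zero: with `P`, `Q`
invertible and `P_r, P_s` the `α`- and `β`-rows of `P`, `Q_r, Q_s` the `α`- and
`γ`-columns of `Q`, the matrices `P_s P_sᴴ` and `Q_sᴴ Q_s` are invertible and
`X = (Π_Q Q_r) D⁻¹ (P_r Π_P)` is the Moore–Penrose pseudoinverse of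
`M = P⁻¹ · fromBlocks(D, O, O, O) · Q⁻¹`. -/
theorem pinv_pencil_decomposition {α β γ : Type} [Fintype α] [Fintype β] [Fintype γ]
    [DecidableEq α] [DecidableEq β] [DecidableEq γ]
    (P : Matrix (α ⊕ β) (α ⊕ β) ℂ) (hP : IsUnit P)
    (Q : Matrix (α ⊕ γ) (α ⊕ γ) ℂ) (hQ : IsUnit Q)
    (D : Matrix α α ℂ) (hD : IsUnit D) :
    let Pr := P.submatrix Sum.inl (id : α ⊕ β → α ⊕ β)
    let Ps := P.submatrix Sum.inr (id : α ⊕ β → α ⊕ β)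
    let Qr := Q.submatrix (id : α ⊕ γ → α ⊕ γ) Sum.inl
    let Qs := Q.submatrix (id : α ⊕ γ → α ⊕ γ) Sum.inr
    let PiQ := (1 : Matrix (α ⊕ γ) (α ⊕ γ) ℂ) - Qs * (Qsᴴ * Qs)⁻¹ * Qsᴴ
    let PiP := (1 : Matrix (α ⊕ β) (α ⊕ β) ℂ) - Psᴴ * (Ps * Psᴴ)⁻¹ * Ps
    let X : Matrix (α ⊕ γ) (α ⊕ β) ℂ := PiQ * Qr * D⁻¹ * (Pr * PiP)
    let M : Matrix (α ⊕ β) (α ⊕ γ) ℂ := P⁻¹ * (Matrix.fromBlocks D 0 0 0 : Matrix (α ⊕ β) (α ⊕ γ) ℂ) * Q⁻¹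
    IsUnit (Ps * Psᴴ) ∧ IsUnit (Qsᴴ * Qs) ∧
    M * X * M = M ∧ X * M * X = X ∧ (M * X)ᴴ = M * X ∧ (X * M)ᴴ = X * M := by
  intro Pr Ps Qr Qs PiQ PiP X M
  have hPP : P * P⁻¹ = 1 := mul_nonsing_inv _ ((isUnit_iff_isUnit_det _).1 hP)
  have hPP' : P⁻¹ * P = 1 := nonsing_inv_mul _ ((isUnit_iff_isUnit_det _).1 hP)
  have hQQ : Q * Q⁻¹ = 1 := mul_nonsing_inv _ ((isUnit_iff_isUnit_det _).1 hQ)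
  have hQQ' : Q⁻¹ * Q = 1 := nonsing_inv_mul _ ((isUnit_iff_isUnit_det _).1 hQ)
  let Ur := P⁻¹.submatrix (id : α ⊕ β → α ⊕ β) Sum.inl
  let Us := P⁻¹.submatrix (id : α ⊕ β → α ⊕ β) Sum.inr
  let Vr := Q⁻¹.submatrix Sum.inl (id : α ⊕ γ → α ⊕ γ)
  let Vs := Q⁻¹.submatrix Sum.inr (id : α ⊕ γ → α ⊕ γ)
  have hPrUr : Pr * Ur = 1 := by
    rw [submatrix_mul_submatrix_of_mul_eq_one hPP, submatrix_one _ Sum.inl_injective]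
  have hPsUs : Ps * Us = 1 := by
    rw [submatrix_mul_submatrix_of_mul_eq_one hPP, submatrix_one _ Sum.inr_injective]
  have hPsUr : Ps * Ur = 0 := by
    rw [submatrix_mul_submatrix_of_mul_eq_one hPP]
    ext i j
    simp
  have hVrQr : Vr * Qr = 1 := by
    rw [submatrix_mul_submatrix_of_mul_eq_one hQQ', submatrix_one _ Sum.inl_injective]
  have hVsQs : Vs * Qs = 1 := by
    rw [submatrix_mul_submatrix_of_mul_eq_one hQQ', submatrix_one _ Sum.inr_injective]
  have hVrQs : Vr * Qs = 0 := by
    rw [submatrix_mul_submatrix_of_mul_eq_one hQQ']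
    ext i j
    simp
  have hU : Ur * Pr + Us * Ps = 1 := (submatrix_inl_mul_add_submatrix_inr_mul _ _).trans hPP'
  have hV : Qr * Vr + Qs * Vs = 1 := (submatrix_inl_mul_add_submatrix_inr_mul _ _).trans hQQ
  have hM : M = Ur * D * Vr := by
    ext i j
    simp [M, Ur, Vr, Matrix.mul_apply]
  have hGP : IsUnit (Ps * Psᴴ) := by
    have h : Usᴴ * Psᴴ = 1 := by rw [← conjTranspose_mul, hPsUs, conjTranspose_one]
    simpa using isUnit_conjTranspose_mul_self_of_mul_eq_one_s7 h
  have hGQ : IsUnit (Qsᴴ * Qs) := isUnit_conjTranspose_mul_self_of_mul_eq_one_s7 hVsQs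
  have hPiQ : PiQ.IsHermitian := isHermitian_one_sub_gram_projection Qs
  have hPiP : PiP.IsHermitian := by
    simpa only [conjTranspose_conjTranspose] using isHermitian_one_sub_gram_projection Psᴴ
  have hPiQQs : PiQ * Qs = 0 := one_sub_gram_projection_mul_self hGQ
  have hPsPiP : Ps * PiP = 0 := by
    have h : PiP * Psᴴ = 0 := by
      simpa only [conjTranspose_conjTranspose] using
        one_sub_gram_projection_mul_self (A := Psᴴ) (by rwa [conjTranspose_conjTranspose])
    simpa [hPiP.eq] using congrArg conjTranspose h
  refine ⟨hGP, hGQ, ?_⟩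
  rw [hM]
  refine penrose_of_factorization hD hPrUr hVrQr hPiP hPiQ ?_ ?_ ?_ ?_
  · rw [Matrix.sub_mul, Matrix.one_mul, Matrix.mul_assoc, hPsUr, Matrix.mul_zero, sub_zero]
  · rw [Matrix.mul_sub, Matrix.mul_one, ← Matrix.mul_assoc, ← Matrix.mul_assoc, hVrQs,
      Matrix.zero_mul, Matrix.zero_mul, sub_zero]
  · rw [eq_sub_of_add_eq hU, Matrix.sub_mul, Matrix.one_mul, Matrix.mul_assoc, hPsPiP,
      Matrix.mul_zero, sub_zero]
  · rw [Matrix.mul_assoc, eq_sub_of_add_eq hV, Matrix.mul_sub, Matrix.mul_one,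
      ← Matrix.mul_assoc, hPiQQs, Matrix.zero_mul, sub_zero]
end

section
/- In the setting of the complex-moment construction: let α = ι ⊕ κ ⊕ μ, β, γ be finite index types; J_in indexed by ι×ι, J_out indexed by κ×κ, N indexed by μ×μ nilpotent; D_A := J_in ⊕ J_out ⊕ I, D_B := I ⊕ I ⊕ N; P invertible over (α⊕β), Q invertible over (α⊕γ); A := P⁻¹·fromBlocks(D_A,O,O,O)·Q⁻¹, B := P⁻¹·fromBlocks(D_B,O,O,O)·Q⁻¹; Q̂_Ω := Π_Q Q_ι and P̂_Ω := P_ι Π_P, where Q_ι, Q_s are the ι- and γ-columns of Q, P_ι, P_s the ι- and β-rows of P, Π_Q := I − Q_s(Q_sᴴQ_s)⁻¹Q_sᴴ, Π_P := I − P_sᴴ(P_sP_sᴴ)⁻¹P_s. Let M_k := Q̂_Ω J_in^k P̂_Ω for k ∈ ℕ. Let L, M ∈ ℕ, V a complex matrix indexed by (α⊕β)×(Fin L), T a complex matrix indexed by (Fin M × Fin L)×(α⊕β), and let S be the matrix indexed by (α⊕γ)×(Fin M × Fin L) whose (k,l)-column block is M_k V, i.e., S(i,(k,l)) = (M_k V)(i,l).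 Assume rank(P̂_Ω V) = |ι| and rank(T · P⁻¹ · E_ι) = |ι|, where E_ι is the (α⊕β)×ι matrix whose ι-rows form the identity and all other rows are zero. Then there exist invertible matrices 𝖰, 𝖯 indexed by (Fin M × Fin L)×(Fin M × Fin L), a finite type κ', and a bijection e : ι ⊕ κ' ≃ Fin M × Fin L such that for every z ∈ ℂ, 𝖰 (z·(T B S) − T A S) 𝖯 equals the reindexing along e of fromBlocks(zI_ι − J_in, O, O, O); i.e., the nonsingular part of the reduced pencil z·TBS − TAS is equivalent to zI − J_in. -/
open Matrix

namespace Matrix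

/-- A matrix of full column rank is carried by an invertible matrix to the (reindexed) matrix whose
top block is the identity and whose bottom block vanishes. -/
lemma exists_isUnit_mul_eq_fromRows {K ι κ n : Type*} [Field K] [Fintype ι] [Fintype κ]
    [Fintype n] [DecidableEq ι] [DecidableEq n] (e : ι ⊕ κ ≃ n) (U : Matrix n ι K)
    (hU : U.rank = Fintype.card ι) :
    ∃ G : Matrix n n K, IsUnit G ∧
      G * U = (fromRows (1 : Matrix ι ι K) (0 : Matrix κ ι K)).submatrix e.symm id := by
  classical
  have hli : LinearIndependent K U.col := by
    rw [linearIndependent_iff_card_eq_finrank_span, ← hU, rank_eq_finrank_span_cols]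
    rfl
  let b := Module.Basis.sumExtend hli
  have : Finite (ι ⊕ Module.Basis.sumExtendIndex hli) := Module.Finite.finite_basis b
  have : Finite (Module.Basis.sumExtendIndex hli) :=
    Finite.of_injective (Sum.inr : _ → ι ⊕ Module.Basis.sumExtendIndex hli) Sum.inr_injective
  have : Fintype (Module.Basis.sumExtendIndex hli) := Fintype.ofFinite _
  have hcard : Fintype.card (Module.Basis.sumExtendIndex hli) = Fintype.card κ := by
    have h₁ := Module.finrank_eq_card_basis b
    have h₂ := Fintype.card_congr e
    rw [Module.finrank_fintype_fun_eq_card] at h₁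
    simp only [Fintype.card_sum] at h₁ h₂
    omega
  let b' := b.reindex (((Equiv.refl ι).sumCongr (Fintype.equivOfCardEq hcard)).trans e)
  have hb' (i : ι) : b' (e (Sum.inl i)) = U.col i := by
    simp [b', b, Module.Basis.sumExtend]
    rfl
  refine ⟨b'.toMatrix (Pi.basisFun K n), ?_, ?_⟩
  · exact IsUnit.of_mul_eq_one _ (b'.toMatrix_mul_toMatrix_flip (Pi.basisFun K n))
  · have hUcol : U = ((Pi.basisFun K n).toMatrix b').submatrix id (e ∘ Sum.inl) := by
      ext i j
      simp [Module.Basis.toMatrix_apply, hb']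
    conv_lhs => rw [hUcol]
    rw [← submatrix_id_id (b'.toMatrix (Pi.basisFun K n)), ← submatrix_mul _ _ _ _ _
      Function.bijective_id, b'.toMatrix_mul_toMatrix_flip]
    ext i j
    obtain ⟨i, rfl⟩ := e.surjective i
    rcases i with i | i <;> simp [one_apply]

/-- If `U` has full column rank and `W` has full row rank, then every product `U * X * W` is
equivalent, through invertible matrices independent of `X`, to `X` padded with zeros. -/
lemma exists_isUnit_mul_mul_eq_reindex_fromBlocks {K ι n : Type*} [Field K] [Fintype ι]
    [Fintype n] [DecidableEq ι] [DecidableEq n] (U : Matrix n ι K) (W : Matrix ι n K)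
    (hU : U.rank = Fintype.card ι) (hW : W.rank = Fintype.card ι) :
    ∃ G H : Matrix n n K, IsUnit G ∧ IsUnit H ∧
      ∃ (κ : Type) (_ : Fintype κ) (e : ι ⊕ κ ≃ n), ∀ X : Matrix ι ι K,
        G * (U * X * W) * H = reindex e e (fromBlocks X 0 0 (0 : Matrix κ κ K)) := by
  have hle : Fintype.card ι ≤ Fintype.card n := hU ▸ rank_le_card_height U
  let e : ι ⊕ Fin (Fintype.card n - Fintype.card ι) ≃ n :=
    Fintype.equivOfCardEq (by simp; omega)
  obtain ⟨G, hG, hGU⟩ := exists_isUnit_mul_eq_fromRows e U hU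
  obtain ⟨H, hH, hHW⟩ := exists_isUnit_mul_eq_fromRows e Wᵀ (by rw [rank_transpose, hW])
  refine ⟨G, Hᵀ, hG, (isUnit_transpose H).2 hH, _, inferInstance, e, fun X => ?_⟩
  have hWH : W * Hᵀ = (fromCols (1 : Matrix ι ι K)
      (0 : Matrix ι (Fin (Fintype.card n - Fintype.card ι)) K)).submatrix id e.symm := by
    rw [← transpose_transpose W, ← transpose_mul, hHW, transpose_submatrix, transpose_fromRows,
      transpose_one, transpose_zero]
  calc G * (U * X * W) * Hᵀ = G * U * X * (W * Hᵀ) := by simp only [Matrix.mul_assoc]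
    _ = _ := by
      rw [hGU, hWH, ← submatrix_id_id X, ← submatrix_mul _ _ _ _ _ Function.bijective_id,
        ← submatrix_mul _ _ _ _ _ Function.bijective_id, fromRows_mul, fromRows_mul_fromCols]
      simp

/-- Multiplying some columns of an invertible matrix by its inverse gives the corresponding
columns of the identity. -/
lemma inv_mul_submatrix_id {K n m : Type*} [CommRing K] [Fintype n] [DecidableEq n]
    {Q : Matrix n n K} (hQ : IsUnit Q) (f : m → n) :
    Q⁻¹ * Q.submatrix id f = (1 : Matrix n n K).submatrix id f := by
  rw [← nonsing_inv_mul Q ((isUnit_iff_isUnit_det Q).1 hQ), submatrix_mul _ _ id id f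
    Function.bijective_id, submatrix_id_id]

/-- A matrix supported on the block `ι ⊕ κ`, block diagonal there, applied to the `ι`-columns of
`Q` corrected by combinations of its `γ`-columns, in the coordinates given by `Q`. -/
lemma fromBlocks_mul_inv_mul_sub {K ι κ β γ : Type*} [CommRing K] [Fintype ι] [Fintype κ]
    [Fintype γ] [DecidableEq ι] [DecidableEq κ] [DecidableEq γ]
    {Q : Matrix ((ι ⊕ κ) ⊕ γ) ((ι ⊕ κ) ⊕ γ) K} (hQ : IsUnit Q) (X : Matrix γ ι K)
    (C : Matrix ι ι K) (D : Matrix κ κ K) :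
    (fromBlocks (fromBlocks C 0 0 D) 0 0 0 : Matrix ((ι ⊕ κ) ⊕ β) ((ι ⊕ κ) ⊕ γ) K) *
        (Q⁻¹ * (Q.submatrix id (Sum.inl ∘ Sum.inl) - Q.submatrix id Sum.inr * X)) =
      fromRows (fromRows (1 : Matrix ι ι K) (0 : Matrix κ ι K)) (0 : Matrix β ι K) * C := by
  have hinl : (1 : Matrix ((ι ⊕ κ) ⊕ γ) ((ι ⊕ κ) ⊕ γ) K).submatrix id (Sum.inl ∘ Sum.inl) =
      fromRows (fromRows (1 : Matrix ι ι K) 0) 0 := by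
    ext ((i | i) | i) j <;> simp [one_apply]
  have hinr : (1 : Matrix ((ι ⊕ κ) ⊕ γ) ((ι ⊕ κ) ⊕ γ) K).submatrix id Sum.inr =
      fromRows 0 (1 : Matrix γ γ K) := by
    ext (i | i) j <;> simp [one_apply]
  rw [Matrix.mul_sub, ← Matrix.mul_assoc Q⁻¹, inv_mul_submatrix_id hQ, inv_mul_submatrix_id hQ,
    hinl, hinr, Matrix.mul_sub, ← Matrix.mul_assoc _ _ X]
  simp [fromBlocks_mul_fromRows, fromRows_mul]

end Matrix

/-- Main theorem of the complex-moment eigensolver for singular pencils: with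
`α = ι ⊕ (κ ⊕ μ)`, `A = P⁻¹ · fromBlocks(J_in ⊕ J_out ⊕ I, O, O, O) · Q⁻¹`,
`B = P⁻¹ · fromBlocks(I ⊕ I ⊕ N, O, O, O) · Q⁻¹` (`N` nilpotent), complex moments
`M_k = Q̂_Ω J_in^k P̂_Ω`, `S` the matrix whose `(k,l)`-column block is `M_k V`, and rank
conditions `rank(P̂_Ω V) = |ι|` and `rank(T P⁻¹ E_ι) = |ι|`, there are invertible `𝖰, 𝖯`
and a bijection `e : ι ⊕ κ' ≃ Fin M × Fin L` such that for all `z`,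
`𝖰 (z·TBS - TAS) 𝖯` is the reindexing along `e` of `fromBlocks(zI - J_in, O, O, O)`;
i.e., the nonsingular part of the reduced pencil `z·TBS - TAS` is equivalent to
`zI - J_in`. -/
theorem reduced_pencil_equiv {ι κ μ β γ : Type} [Fintype ι] [Fintype κ] [Fintype μ]
    [Fintype β] [Fintype γ]
    [DecidableEq ι] [DecidableEq κ] [DecidableEq μ] [DecidableEq β] [DecidableEq γ]
    (Jin : Matrix ι ι ℂ) (Jout : Matrix κ κ ℂ) (N : Matrix μ μ ℂ) (hN : IsNilpotent N)
    (P : Matrix ((ι ⊕ (κ ⊕ μ)) ⊕ β) ((ι ⊕ (κ ⊕ μ)) ⊕ β) ℂ) (hP : IsUnit P)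
    (Q : Matrix ((ι ⊕ (κ ⊕ μ)) ⊕ γ) ((ι ⊕ (κ ⊕ μ)) ⊕ γ) ℂ) (hQ : IsUnit Q)
    (A B : Matrix ((ι ⊕ (κ ⊕ μ)) ⊕ β) ((ι ⊕ (κ ⊕ μ)) ⊕ γ) ℂ)
    (hA : A = P⁻¹ *
      (Matrix.fromBlocks
        (Matrix.fromBlocks Jin 0 0 (Matrix.fromBlocks Jout 0 0 (1 : Matrix μ μ ℂ))) 0 0 0 :
          Matrix ((ι ⊕ (κ ⊕ μ)) ⊕ β) ((ι ⊕ (κ ⊕ μ)) ⊕ γ) ℂ) * Q⁻¹)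
    (hB : B = P⁻¹ *
      (Matrix.fromBlocks
        (Matrix.fromBlocks (1 : Matrix ι ι ℂ) 0 0
          (Matrix.fromBlocks (1 : Matrix κ κ ℂ) 0 0 N)) 0 0 0 :
          Matrix ((ι ⊕ (κ ⊕ μ)) ⊕ β) ((ι ⊕ (κ ⊕ μ)) ⊕ γ) ℂ) * Q⁻¹)
    (QhatΩ : Matrix ((ι ⊕ (κ ⊕ μ)) ⊕ γ) ι ℂ)
    (hQhat : QhatΩ = ((1 : Matrix ((ι ⊕ (κ ⊕ μ)) ⊕ γ) ((ι ⊕ (κ ⊕ μ)) ⊕ γ) ℂ) -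
        Q.submatrix id Sum.inr *
          ((Q.submatrix id Sum.inr)ᴴ * Q.submatrix id Sum.inr)⁻¹ *
            (Q.submatrix id Sum.inr)ᴴ) *
      Q.submatrix id (Sum.inl ∘ Sum.inl))
    (PhatΩ : Matrix ι ((ι ⊕ (κ ⊕ μ)) ⊕ β) ℂ)
    (hPhat : PhatΩ = P.submatrix (Sum.inl ∘ Sum.inl) id *
      ((1 : Matrix ((ι ⊕ (κ ⊕ μ)) ⊕ β) ((ι ⊕ (κ ⊕ μ)) ⊕ β) ℂ) -
        (P.submatrix Sum.inr id)ᴴ *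
          (P.submatrix Sum.inr id * (P.submatrix Sum.inr id)ᴴ)⁻¹ *
            P.submatrix Sum.inr id))
    (L M : ℕ)
    (V : Matrix ((ι ⊕ (κ ⊕ μ)) ⊕ β) (Fin L) ℂ)
    (T : Matrix (Fin M × Fin L) ((ι ⊕ (κ ⊕ μ)) ⊕ β) ℂ)
    (S : Matrix ((ι ⊕ (κ ⊕ μ)) ⊕ γ) (Fin M × Fin L) ℂ)
    (hS : ∀ (i : (ι ⊕ (κ ⊕ μ)) ⊕ γ) (k : Fin M) (l : Fin L),
      S i (k, l) = (QhatΩ * Jin ^ (k : ℕ) * PhatΩ * V) i l)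
    (hrankV : (PhatΩ * V).rank = Fintype.card ι)
    (hrankT : (T * P⁻¹ *
        Matrix.fromRows (Matrix.fromRows (1 : Matrix ι ι ℂ) (0 : Matrix (κ ⊕ μ) ι ℂ))
          (0 : Matrix β ι ℂ)).rank = Fintype.card ι) :
    ∃ QQ PP : Matrix (Fin M × Fin L) (Fin M × Fin L) ℂ, IsUnit QQ ∧ IsUnit PP ∧
      ∃ (κ' : Type) (_ : Fintype κ') (e : ι ⊕ κ' ≃ Fin M × Fin L),
        ∀ z : ℂ, QQ * (z • (T * B * S) - T * A * S) * PP =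
          Matrix.reindex e e
            (Matrix.fromBlocks (z • (1 : Matrix ι ι ℂ) - Jin) 0 0 (0 : Matrix κ' κ' ℂ)) := by
  let R := fromRows (fromRows (1 : Matrix ι ι ℂ) (0 : Matrix (κ ⊕ μ) ι ℂ)) (0 : Matrix β ι ℂ)
  let W : Matrix ι (Fin M × Fin L) ℂ := of fun i kl => (Jin ^ (kl.1 : ℕ) * (PhatΩ * V)) i kl.2
  have hSW : S = QhatΩ * W := by
    ext i ⟨k, l⟩
    rw [hS, Matrix.mul_assoc, Matrix.mul_assoc, mul_apply, mul_apply]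
    rfl
  have hW : W.rank = Fintype.card ι := by
    refine le_antisymm (rank_le_card_height W) ?_
    rcases M.eq_zero_or_pos with rfl | hM
    · rw [← hrankT]
      exact (rank_le_card_height _).trans (by simp)
    · have hsub : W.submatrix id (fun l => (⟨0, hM⟩, l)) = PhatΩ * V := by
        ext i l
        simp [W]
      rw [← hrankV, ← hsub]
      exact rank_submatrix_le W id _
  have hQhat' : QhatΩ = Q.submatrix id (Sum.inl ∘ Sum.inl) - Q.submatrix id Sum.inr *
      (((Q.submatrix id Sum.inr)ᴴ * Q.submatrix id Sum.inr)⁻¹ *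
        (Q.submatrix id Sum.inr)ᴴ * Q.submatrix id (Sum.inl ∘ Sum.inl)) := by
    rw [hQhat, Matrix.sub_mul, Matrix.one_mul]
    simp only [Matrix.mul_assoc]
  have hAQ : A * QhatΩ = P⁻¹ * (R * Jin) := by
    rw [hA, hQhat', Matrix.mul_assoc, Matrix.mul_assoc, fromBlocks_mul_inv_mul_sub hQ]
  have hBQ : B * QhatΩ = P⁻¹ * R := by
    rw [hB, hQhat', Matrix.mul_assoc, Matrix.mul_assoc, fromBlocks_mul_inv_mul_sub hQ,
      Matrix.mul_one]
  obtain ⟨G, H, hG, hH, κ', hκ', e, he⟩ :=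
    exists_isUnit_mul_mul_eq_reindex_fromBlocks (T * P⁻¹ * R) W hrankT hW
  refine ⟨G, H, hG, hH, κ', hκ', e, fun z => ?_⟩
  rw [← he]
  congr 2
  calc z • (T * B * S) - T * A * S
      = z • (T * (B * QhatΩ) * W) - T * (A * QhatΩ) * W := by
        simp only [hSW, Matrix.mul_assoc]
    _ = T * P⁻¹ * R * (z • (1 : Matrix ι ι ℂ) - Jin) * W := by
        rw [hAQ, hBQ]
        simp only [Matrix.mul_sub, Matrix.sub_mul, Matrix.mul_smul, Matrix.smul_mul,
          Matrix.mul_one, Matrix.mul_assoc]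
end

section
/- Let α = ι ⊕ κ, β, γ be finite index types, P an invertible complex matrix indexed by (α⊕β)×(α⊕β), Q an invertible complex matrix indexed by (α⊕γ)×(α⊕γ), J a complex matrix indexed by ι×ι, and D' a complex matrix indexed by κ×κ. Set D_A := J ⊕ D' and A := P⁻¹·fromBlocks(D_A,O,O,O)·Q⁻¹. Write Q_ι for the ι-columns of Q, Q_s for the γ-columns of Q, P_ι for the ι-rows of P, P_s for the β-rows of P, Π_Q := I − Q_s(Q_sᴴQ_s)⁻¹Q_sᴴ, Π_P := I − P_sᴴ(P_sP_sᴴ)⁻¹P_s, Q̂_Ω := Π_Q Q_ι, P̂_Ω := P_ι Π_P, and M_k := Q̂_Ω J^k P̂_Ω for k ∈ ℕ. Then for every k ∈ ℕ, P · A · M_k = fromBlocks(I_α, O, O, O) · Q⁻¹ · M_{k+1}. -/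
open Matrix

/-- Multiplying by `Q⁻¹` and then by selected columns of `Q` selects the same columns. -/
lemma mul_inv_mul_submatrix_id {l n m R : Type*} [Fintype n] [DecidableEq n] [CommRing R]
    (F : Matrix l n R) {Q : Matrix n n R} (hQ : IsUnit Q) (f : m → n) :
    F * Q⁻¹ * Q.submatrix id f = F.submatrix id f := by
  have h : F * Q⁻¹ * Q.submatrix id f = (F * Q⁻¹ * Q).submatrix id f := rfl
  rw [h, Matrix.nonsing_inv_mul_cancel_right _ _ ((Matrix.isUnit_iff_isUnit_det Q).mp hQ)]

/-- If `F` vanishes on the columns selected by `g`, then subtracting from columns of `Q` any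
combination of its `g`-columns is invisible to `F * Q⁻¹`. -/
lemma mul_inv_mul_one_sub_mul_submatrix {l n m p R : Type*} [Fintype n] [DecidableEq n]
    [Fintype p] [CommRing R] (F : Matrix l n R) {Q : Matrix n n R} (hQ : IsUnit Q)
    (f : m → n) (g : p → n) (hF : F.submatrix id g = 0) (X : Matrix p n R) :
    F * Q⁻¹ * ((1 - Q.submatrix id g * X) * Q.submatrix id f) = F.submatrix id f := by
  rw [Matrix.sub_mul, Matrix.one_mul, Matrix.mul_sub, mul_inv_mul_submatrix_id F hQ,
    Matrix.mul_assoc (Q.submatrix id g), ← Matrix.mul_assoc (F * Q⁻¹), mul_inv_mul_submatrix_id F hQ, hF,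
    Matrix.zero_mul, sub_zero]

/-- With `α = ι ⊕ κ`, `A = P⁻¹ · fromBlocks(J ⊕ D', O, O, O) · Q⁻¹` and complex moments
`M_k = Q̂_Ω J^k P̂_Ω`, one has `P A M_k = fromBlocks(I_α, O, O, O) · Q⁻¹ · M_{k+1}`
for every `k`. -/
theorem pencil_A_moment_shift {ι κ β γ : Type} [Fintype ι] [Fintype κ] [Fintype β]
    [Fintype γ] [DecidableEq ι] [DecidableEq κ] [DecidableEq β] [DecidableEq γ]
    (P : Matrix ((ι ⊕ κ) ⊕ β) ((ι ⊕ κ) ⊕ β) ℂ) (hP : IsUnit P)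
    (Q : Matrix ((ι ⊕ κ) ⊕ γ) ((ι ⊕ κ) ⊕ γ) ℂ) (hQ : IsUnit Q)
    (J : Matrix ι ι ℂ) (D' : Matrix κ κ ℂ) :
    let A : Matrix ((ι ⊕ κ) ⊕ β) ((ι ⊕ κ) ⊕ γ) ℂ :=
      P⁻¹ * (Matrix.fromBlocks (Matrix.fromBlocks J 0 0 D') 0 0 0 :
        Matrix ((ι ⊕ κ) ⊕ β) ((ι ⊕ κ) ⊕ γ) ℂ) * Q⁻¹
    let Qι := Q.submatrix (id : (ι ⊕ κ) ⊕ γ → (ι ⊕ κ) ⊕ γ) (Sum.inl ∘ Sum.inl)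
    let Qs := Q.submatrix (id : (ι ⊕ κ) ⊕ γ → (ι ⊕ κ) ⊕ γ) Sum.inr
    let Pι := P.submatrix (Sum.inl ∘ Sum.inl) (id : (ι ⊕ κ) ⊕ β → (ι ⊕ κ) ⊕ β)
    let Ps := P.submatrix Sum.inr (id : (ι ⊕ κ) ⊕ β → (ι ⊕ κ) ⊕ β)
    let QhatΩ := ((1 : Matrix ((ι ⊕ κ) ⊕ γ) ((ι ⊕ κ) ⊕ γ) ℂ) - Qs * (Qsᴴ * Qs)⁻¹ * Qsᴴ) * Qι
    let PhatΩ := Pι * ((1 : Matrix ((ι ⊕ κ) ⊕ β) ((ι ⊕ κ) ⊕ β) ℂ) - Psᴴ * (Ps * Psᴴ)⁻¹ * Ps)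
    let Mk : ℕ → Matrix ((ι ⊕ κ) ⊕ γ) ((ι ⊕ κ) ⊕ β) ℂ := fun k => QhatΩ * J ^ k * PhatΩ
    ∀ k : ℕ,
      P * A * Mk k =
        (Matrix.fromBlocks (1 : Matrix (ι ⊕ κ) (ι ⊕ κ) ℂ) 0 0 0 :
          Matrix ((ι ⊕ κ) ⊕ β) ((ι ⊕ κ) ⊕ γ) ℂ) * Q⁻¹ * Mk (k + 1) := by
  intro A Qι Qs Pι Ps QhatΩ PhatΩ Mk k
  have hhat : ∀ B : Matrix (ι ⊕ κ) (ι ⊕ κ) ℂ,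
      (fromBlocks B 0 0 0 : Matrix ((ι ⊕ κ) ⊕ β) ((ι ⊕ κ) ⊕ γ) ℂ) * Q⁻¹ * QhatΩ =
        (fromBlocks B 0 0 0 : Matrix ((ι ⊕ κ) ⊕ β) ((ι ⊕ κ) ⊕ γ) ℂ).submatrix id
          (Sum.inl ∘ Sum.inl) := by
    intro B
    simp only [QhatΩ, Matrix.mul_assoc Qs]
    refine mul_inv_mul_one_sub_mul_submatrix _ hQ _ _ ?_ _
    ext (i | i) j <;> rfl
  have hJ : (fromBlocks (fromBlocks J 0 0 D') 0 0 0 :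
        Matrix ((ι ⊕ κ) ⊕ β) ((ι ⊕ κ) ⊕ γ) ℂ).submatrix id (Sum.inl ∘ Sum.inl) =
      (fromBlocks 1 0 0 0 : Matrix ((ι ⊕ κ) ⊕ β) ((ι ⊕ κ) ⊕ γ) ℂ).submatrix id
        (Sum.inl ∘ Sum.inl) * J := by
    ext ((i | i) | i) j <;> simp [Matrix.mul_apply, Matrix.one_apply]
  have hPA : P * A = (fromBlocks (fromBlocks J 0 0 D') 0 0 0 :
      Matrix ((ι ⊕ κ) ⊕ β) ((ι ⊕ κ) ⊕ γ) ℂ) * Q⁻¹ := by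
    simp only [A, Matrix.mul_assoc P⁻¹]
    exact Matrix.mul_nonsing_inv_cancel_left _ _ ((Matrix.isUnit_iff_isUnit_det P).mp hP)
  simp only [Mk]
  rw [hPA, Matrix.mul_assoc QhatΩ, Matrix.mul_assoc QhatΩ, ← Matrix.mul_assoc _ QhatΩ,
    ← Matrix.mul_assoc _ QhatΩ, hhat, hhat, hJ, pow_succ', Matrix.mul_assoc, Matrix.mul_assoc J]
end

section
/- Let α and γ be finite index types and Q an invertible complex matrix indexed by (α⊕γ)×(α⊕γ). Write Q_r for the α-columns of Q and Q_s for the γ-columns of Q, and let Π_Q := I − Q_s(Q_sᴴQ_s)⁻¹Q_sᴴ. Then Q⁻¹ · (Π_Q Q_r) is the (α⊕γ)×α matrix whose α-rows form the identity matrix I_α and whose γ-rows equal −(Q_sᴴQ_s)⁻¹Q_sᴴQ_r; in particular, the α-rows of Q⁻¹ · Π_Q · Q_r equal I_α. -/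
open Matrix

/-- For an invertible `Q` with `α`-columns `Q_r` and `γ`-columns `Q_s`, and
`Π_Q = I - Q_s (Q_sᴴ Q_s)⁻¹ Q_sᴴ` the orthogonal projector onto the orthogonal
complement of the column space of `Q_s`, the matrix `Q⁻¹ · (Π_Q Q_r)` has its `α`-rows
equal to the identity `I_α` and its `γ`-rows equal to `-(Q_sᴴ Q_s)⁻¹ Q_sᴴ Q_r`. -/
theorem inv_mul_proj_cols {α γ : Type} [Fintype α] [Fintype γ]
    [DecidableEq α] [DecidableEq γ]
    (Q : Matrix (α ⊕ γ) (α ⊕ γ) ℂ) (hQ : IsUnit Q) :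
    let Qr := Q.submatrix (id : α ⊕ γ → α ⊕ γ) Sum.inl
    let Qs := Q.submatrix (id : α ⊕ γ → α ⊕ γ) Sum.inr
    let PiQ := (1 : Matrix (α ⊕ γ) (α ⊕ γ) ℂ) - Qs * (Qsᴴ * Qs)⁻¹ * Qsᴴ
    Q⁻¹ * (PiQ * Qr) =
      Matrix.fromRows (1 : Matrix α α ℂ) (-((Qsᴴ * Qs)⁻¹ * Qsᴴ * Qr)) ∧
    (Q⁻¹ * (PiQ * Qr)).submatrix Sum.inl (id : α → α) = (1 : Matrix α α ℂ) := by
  intro Qr Qs PiQ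
  have hcols : PiQ * Qr =
      Q * Matrix.fromRows (1 : Matrix α α ℂ) (-((Qsᴴ * Qs)⁻¹ * Qsᴴ * Qr)) := by
    have hsplit : Q = Matrix.fromCols Qr Qs := by
      ext i (j | j) <;> rfl
    conv_rhs => rw [hsplit]
    rw [Matrix.fromCols_mul_fromRows]
    simp only [PiQ, Matrix.sub_mul, Matrix.one_mul, Matrix.mul_one, Matrix.mul_neg,
      Matrix.mul_assoc, ← sub_eq_add_neg]
  have hinv : Q⁻¹ * (PiQ * Qr) =
      Matrix.fromRows (1 : Matrix α α ℂ) (-((Qsᴴ * Qs)⁻¹ * Qsᴴ * Qr)) := by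
    rw [hcols, Matrix.nonsing_inv_mul_cancel_left _ _ ((Matrix.isUnit_iff_isUnit_det Q).mp hQ)]
  refine ⟨hinv, ?_⟩
  rw [hinv]
  rfl
end

section
/- Let α and γ be finite index types and Q an invertible complex matrix indexed by (α⊕γ)×(α⊕γ). Write Q_r for the α-columns of Q and Q_s for the γ-columns of Q, and let Π_Q := I − Q_s(Q_sᴴQ_s)⁻¹Q_sᴴ. Then rank(Π_Q Q_r) = |α|; i.e., the projected matrix Π_Q Q_r has full column rank. -/
open Matrix

/-- For an invertible `Q` with `α`-columns `Q_r` and `γ`-columns `Q_s`, and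
`Π_Q = I - Q_s (Q_sᴴ Q_s)⁻¹ Q_sᴴ` the orthogonal projector onto the orthogonal
complement of the column space of `Q_s`, the projected matrix `Π_Q Q_r` has full column
rank: `rank(Π_Q Q_r) = |α|`. -/
theorem proj_cols_full_rank {α γ : Type} [Fintype α] [Fintype γ]
    [DecidableEq α] [DecidableEq γ]
    (Q : Matrix (α ⊕ γ) (α ⊕ γ) ℂ) (hQ : IsUnit Q) :
    let Qr := Q.submatrix (id : α ⊕ γ → α ⊕ γ) Sum.inl
    let Qs := Q.submatrix (id : α ⊕ γ → α ⊕ γ) Sum.inr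
    let PiQ := (1 : Matrix (α ⊕ γ) (α ⊕ γ) ℂ) - Qs * (Qsᴴ * Qs)⁻¹ * Qsᴴ
    (PiQ * Qr).rank = Fintype.card α := by
  intro Qr Qs PiQ
  have hinv : Q⁻¹ * Q = 1 := nonsing_inv_mul Q ((isUnit_iff_isUnit_det Q).mp hQ)
  let L := Q⁻¹.submatrix Sum.inl (id : α ⊕ γ → α ⊕ γ)
  have hLr : L * Qr = 1 := by
    rw [← submatrix_mul _ _ _ _ _ Function.bijective_id, hinv]
    exact submatrix_one _ Sum.inl_injective
  have hLs : L * Qs = 0 := by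
    rw [← submatrix_mul _ _ _ _ _ Function.bijective_id, hinv]
    ext i j
    simp
  have hL : L * (PiQ * Qr) = 1 := by
    simp only [PiQ, Matrix.sub_mul, Matrix.mul_sub, Matrix.one_mul, Matrix.mul_assoc, hLr]
    rw [← Matrix.mul_assoc L Qs, hLs, Matrix.zero_mul, sub_zero]
  refine le_antisymm (rank_le_card_width _) ?_
  calc Fintype.card α = (L * (PiQ * Qr)).rank := by rw [hL, rank_one]
    _ ≤ (PiQ * Qr).rank := rank_mul_le_right _ _
end

section
/- Let α, γ, ι be finite index types with ι a sub-index of α (α = ι ⊕ κ), and let Q be an invertible complex matrix indexed by (α⊕γ)×(α⊕γ). Write Q_ι for the ι-columns of Q, Q_s for the γ-columns of Q, Π_Q := I − Q_s(Q_sᴴQ_s)⁻¹Q_sᴴ, and Q̂_Ω := Π_Q Q_ι. Then for every complex matrix Y indexed by ι×τ (for any finite index type τ), the matrix S := Q̂_Ω Y satisfies rank S = rank Y. In particular, if S is the matrix whose (k,l)-column blocks are M_k V = Q̂_Ω J^k P̂_Ω V (for any matrices J indexed by ι×ι, P̂_Ω indexed by ι×m, V indexed by m×(Fin L), and k ranging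 over Fin M), then S = Q̂_Ω Y with Y the ι×(Fin M × Fin L) matrix whose (k,l)-column blocks are J^k P̂_Ω V, and rank S = rank Y. -/
open Matrix

/-- Multiplication on the left by a matrix that has a left inverse preserves the rank. -/
lemma Matrix.rank_mul_eq_right_of_mul_eq_one {R m n o : Type*} [CommRing R]
    [StrongRankCondition R] [Fintype m] [Fintype n] [Fintype o] [DecidableEq n]
    {A : Matrix m n R} {B : Matrix n m R} (h : B * A = 1) (Y : Matrix n o R) :
    (A * Y).rank = Y.rank := by
  refine le_antisymm (rank_mul_le_right A Y) ?_
  calc Y.rank = (B * (A * Y)).rank := by rw [← Matrix.mul_assoc, h, Matrix.one_mul]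
    _ ≤ (A * Y).rank := rank_mul_le_right B (A * Y)

/-- Subtracting from some columns of an invertible matrix a combination of other columns
leaves a matrix with a left inverse, namely the corresponding rows of the inverse. -/
lemma Matrix.submatrix_inv_mul_one_sub_mul_submatrix {R n a b : Type*} [CommRing R] [Fintype n]
    [DecidableEq n] [DecidableEq a] [Fintype b] {Q : Matrix n n R} (hQ : IsUnit Q)
    {f : a → n} {g : b → n} (hf : Function.Injective f) (hfg : ∀ i j, f i ≠ g j)
    (X : Matrix b n R) :
    Q⁻¹.submatrix f id * ((1 - Q.submatrix id g * X) * Q.submatrix id f) = 1 := by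
  have hinv : Q⁻¹ * Q = 1 := nonsing_inv_mul Q ((isUnit_iff_isUnit_det Q).mp hQ)
  have hone : Q⁻¹.submatrix f id * Q.submatrix id f = 1 := by
    rw [← submatrix_mul _ _ _ _ _ Function.bijective_id, hinv, submatrix_one _ hf]
  have hzero : Q⁻¹.submatrix f id * Q.submatrix id g = 0 := by
    rw [← submatrix_mul _ _ _ _ _ Function.bijective_id, hinv]
    ext i j
    simp [one_apply_ne (hfg i j)]
  rw [← Matrix.mul_assoc, Matrix.mul_sub, ← Matrix.mul_assoc, hzero, Matrix.zero_mul, sub_zero,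
    Matrix.mul_one, hone]

/-- With `α = ι ⊕ κ`, `Q` invertible, `Q̂_Ω = Π_Q Q_ι` (the projection of the
`ι`-columns of `Q` onto the orthogonal complement of the column space of the
`γ`-columns `Q_s`), multiplication by `Q̂_Ω` preserves rank: `rank(Q̂_Ω Y) = rank Y` for
every `Y`. In particular, the matrix `S` whose `(k,l)`-column blocks are
`M_k V = Q̂_Ω J^k P̂_Ω V` factors as `S = Q̂_Ω Y` with `Y` the matrix whose
`(k,l)`-column blocks are `J^k P̂_Ω V`, and `rank S = rank Y`. -/
theorem rank_moment_block_matrix {ι κ γ τ m' : Type} [Fintype ι] [Fintype κ] [Fintype γ]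
    [Fintype τ] [Fintype m'] [DecidableEq ι] [DecidableEq κ] [DecidableEq γ]
    (Q : Matrix ((ι ⊕ κ) ⊕ γ) ((ι ⊕ κ) ⊕ γ) ℂ) (hQ : IsUnit Q)
    (QhatΩ : Matrix ((ι ⊕ κ) ⊕ γ) ι ℂ)
    (hQhat : QhatΩ = ((1 : Matrix ((ι ⊕ κ) ⊕ γ) ((ι ⊕ κ) ⊕ γ) ℂ) -
        Q.submatrix id Sum.inr *
          ((Q.submatrix id Sum.inr)ᴴ * Q.submatrix id Sum.inr)⁻¹ *
            (Q.submatrix id Sum.inr)ᴴ) *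
      Q.submatrix id (Sum.inl ∘ Sum.inl))
    (Y : Matrix ι τ ℂ)
    (J : Matrix ι ι ℂ) (PhatΩ : Matrix ι m' ℂ) (L M : ℕ) (V : Matrix m' (Fin L) ℂ)
    (S : Matrix ((ι ⊕ κ) ⊕ γ) (Fin M × Fin L) ℂ)
    (hS : ∀ (i : (ι ⊕ κ) ⊕ γ) (k : Fin M) (l : Fin L),
      S i (k, l) = (QhatΩ * J ^ (k : ℕ) * PhatΩ * V) i l) :
    (QhatΩ * Y).rank = Y.rank ∧
    S = QhatΩ *
      Matrix.of (fun (i : ι) (kl : Fin M × Fin L) => (J ^ (kl.1 : ℕ) * PhatΩ * V) i kl.2) ∧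
    S.rank =
      (Matrix.of
        (fun (i : ι) (kl : Fin M × Fin L) => (J ^ (kl.1 : ℕ) * PhatΩ * V) i kl.2)).rank := by
  have hleft : Q⁻¹.submatrix (Sum.inl ∘ Sum.inl) id * QhatΩ = 1 := by
    rw [hQhat, Matrix.mul_assoc (Q.submatrix id Sum.inr)]
    exact submatrix_inv_mul_one_sub_mul_submatrix hQ
      (Sum.inl_injective.comp Sum.inl_injective) (fun _ _ => Sum.inl_ne_inr) _
  have hfactor : S = QhatΩ *
      Matrix.of (fun (i : ι) (kl : Fin M × Fin L) =>
        (J ^ (kl.1 : ℕ) * PhatΩ * V) i kl.2) := by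
    ext i ⟨k, l⟩
    rw [hS, Matrix.mul_assoc, Matrix.mul_assoc, ← Matrix.mul_assoc (J ^ (k : ℕ))]
    rw [Matrix.mul_apply (M := QhatΩ), Matrix.mul_apply (M := QhatΩ)]
    rfl
  refine ⟨rank_mul_eq_right_of_mul_eq_one hleft Y, hfactor, ?_⟩
  rw [hfactor, rank_mul_eq_right_of_mul_eq_one hleft]
end
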